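/- arXiv:1505.07217 — 3 statements merged into one kernel-verified Lean document; each statement's English description precedes it below -/
import Mathlib

section
/- For every integer n ≥ 3, every real c > 0 and every x ≥ 0, one has ((n−2)/√(n(n−1)))·√(x·(γ(x) − x/n)) + γ(x) ≤ (2/n)·x + n·c. -/
open Real Filter

noncomputable def alphaF (n : ℕ) (c : ℝ) (x : ℝ) : ℝ :=
  (n : ℝ) * c + ((n : ℝ) / (2 * ((n : ℝ) - 1))) * x
    - (((n : ℝ) - 2) / (2 * ((n : ℝ) - 1))) * Real.sqrt (x ^ 2 + 4 * ((n : ℝ) - 1) * c * x)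

noncomputable def yn (n : ℕ) : ℝ :=
  4 * (1 - (n : ℝ)) + (2 * ((n : ℝ) ^ 2 - 4) / Real.sqrt (2 * (n : ℝ) - 5)) *
    Real.cos ((1 / 3) * Real.arctan (((n : ℝ) ^ 2 - 4 * (n : ℝ) + 6) /
      (2 * ((n : ℝ) - 1) * Real.sqrt (2 * (n : ℝ) - 5))))

noncomputable def x0 (n : ℕ) (c : ℝ) : ℝ := yn n * c

noncomputable def betaF (n : ℕ) (c : ℝ) (x : ℝ) : ℝ :=
  alphaF n c (x0 n c) + deriv (alphaF n c) (x0 n c) * (x - x0 n c)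
    + (1 / 2) * deriv (deriv (alphaF n c)) (x0 n c) * (x - x0 n c) ^ 2

noncomputable def gammaF (n : ℕ) (c : ℝ) (x : ℝ) : ℝ :=
  if x0 n c ≤ x then alphaF n c x else betaF n c x

noncomputable def gammaF' (n : ℕ) (c : ℝ) (x : ℝ) : ℝ :=
  derivWithin (gammaF n c) (Set.Ici 0) x

noncomputable def gammaF'' (n : ℕ) (c : ℝ) (x : ℝ) : ℝ :=
  derivWithin (gammaF' n c) (Set.Ici 0) x

noncomputable def omegaF (n : ℕ) (c : ℝ) (x : ℝ) : ℝ :=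
  (x ^ 2 / Real.sqrt (x ^ 2 + 4 * ((n : ℝ) - 1) * c * x)) *
    ((1 + (n : ℝ) ^ 2 * c / x) *
      (((n : ℝ) / ((n : ℝ) - 2) - (1 + 4 * ((n : ℝ) - 1) * c / x) ^ (-(1 / 2) : ℝ)) /
       ((n : ℝ) / ((n : ℝ) - 2) + (1 + 4 * ((n : ℝ) - 1) * c / x) ^ (-(1 / 2) : ℝ)))) ^ 2

/-- The radical in `alphaF` lies below its second-order Taylor polynomial to the left of `a`. -/
lemma sqrt_le_taylor_two {p a x : ℝ} (hp : 0 < p) (hx : 0 ≤ x) (hxa : x ≤ a) (ha : 0 < a) :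
    √(x ^ 2 + 2 * p * x) ≤ √(a ^ 2 + 2 * p * a) + (a + p) / √(a ^ 2 + 2 * p * a) * (x - a)
      + 1 / 2 * (-p ^ 2 / √(a ^ 2 + 2 * p * a) ^ 3) * (x - a) ^ 2 := by
  have hs : 0 < √(a ^ 2 + 2 * p * a) := Real.sqrt_pos.2 (by positivity)
  have hs2 : √(a ^ 2 + 2 * p * a) ^ 2 = a ^ 2 + 2 * p * a := Real.sq_sqrt (by positivity)
  set s := √(a ^ 2 + 2 * p * a)
  obtain ⟨d, rfl⟩ : ∃ d, x = a - d := ⟨a - x, by ring⟩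
  have hd : 0 ≤ d := by linarith
  have hda : d ≤ a := by linarith
  refine Real.sqrt_le_iff.2 ⟨?_, ?_⟩
  · have key : 0 ≤ 2 * s ^ 4 - 2 * (a + p) * d * s ^ 2 - p ^ 2 * d ^ 2 := by
      have h1 : p ^ 2 * d ^ 2 ≤ p ^ 2 * a ^ 2 := by gcongr
      have h2 : 2 * (a + p) * d * s ^ 2 ≤ 2 * (a + p) * a * s ^ 2 := by gcongr
      have h3 : 2 * s ^ 4 - 2 * (a + p) * a * s ^ 2 - p ^ 2 * a ^ 2
          = 2 * p * a ^ 3 + 3 * p ^ 2 * a ^ 2 := by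
        rw [show s ^ 4 = (s ^ 2) ^ 2 by ring, hs2]; ring
      have h4 : 0 ≤ 2 * p * a ^ 3 + 3 * p ^ 2 * a ^ 2 := by positivity
      linarith
    have e : s + (a + p) / s * (a - d - a) + 1 / 2 * (-p ^ 2 / s ^ 3) * (a - d - a) ^ 2
        = (2 * s ^ 4 - 2 * (a + p) * d * s ^ 2 - p ^ 2 * d ^ 2) / (2 * s ^ 3) := by
      field_simp
      ring
    rw [e]
    positivity
  · have e : (s + (a + p) / s * (a - d - a) + 1 / 2 * (-p ^ 2 / s ^ 3) * (a - d - a) ^ 2) ^ 2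
        = s ^ 2 - 2 * (a + p) * d + ((a + p) ^ 2 - p ^ 2) / s ^ 2 * d ^ 2
          + (a + p) * p ^ 2 * d ^ 3 / s ^ 4 + p ^ 4 * d ^ 4 / (4 * s ^ 6) := by
      field_simp
      ring
    have h1 : ((a + p) ^ 2 - p ^ 2) / s ^ 2 = 1 := by
      rw [div_eq_one_iff_eq (by positivity), hs2]; ring
    have h2 : 0 ≤ (a + p) * p ^ 2 * d ^ 3 / s ^ 4 := by positivity
    have h3 : 0 ≤ p ^ 4 * d ^ 4 / (4 * s ^ 6) := by positivity
    rw [e, h1, hs2]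
    nlinarith

lemma hasDerivAt_sqrt_sq_add {p x : ℝ} (hp : 0 < p) (hx : 0 < x) :
    HasDerivAt (fun y ↦ √(y ^ 2 + 2 * p * y)) ((x + p) / √(x ^ 2 + 2 * p * x)) x := by
  have hpos : 0 < x ^ 2 + 2 * p * x := by positivity
  have h := (((hasDerivAt_id x).pow 2).add ((hasDerivAt_id x).const_mul (2 * p))).sqrt hpos.ne'
  refine h.congr_deriv ?_
  simp
  field_simp

lemma hasDerivAt_div_sqrt_sq_add {p x : ℝ} (hp : 0 < p) (hx : 0 < x) :
    HasDerivAt (fun y ↦ (y + p) / √(y ^ 2 + 2 * p * y))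
      (-p ^ 2 / √(x ^ 2 + 2 * p * x) ^ 3) x := by
  have hs : 0 < √(x ^ 2 + 2 * p * x) := Real.sqrt_pos.2 (by positivity)
  have hs2 : √(x ^ 2 + 2 * p * x) ^ 2 = x ^ 2 + 2 * p * x := Real.sq_sqrt (by positivity)
  refine (((hasDerivAt_id x).add_const p).div (hasDerivAt_sqrt_sq_add hp hx) hs.ne').congr_deriv ?_
  simp only [id]
  set s := √(x ^ 2 + 2 * p * x)
  field_simp
  rw [hs2]
  ring

lemma alphaF_eq (n : ℕ) (c x : ℝ) :
    alphaF n c x = n * c + n / (2 * ((n : ℝ) - 1)) * x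
      - ((n : ℝ) - 2) / (2 * ((n : ℝ) - 1)) * √(x ^ 2 + 2 * (2 * ((n : ℝ) - 1) * c) * x) := by
  rw [alphaF]
  ring_nf

lemma hasDerivAt_alphaF {n : ℕ} {c x : ℝ} (hn : 3 ≤ n) (hc : 0 < c) (hx : 0 < x) :
    HasDerivAt (alphaF n c) (n / (2 * ((n : ℝ) - 1)) - ((n : ℝ) - 2) / (2 * ((n : ℝ) - 1)) *
      ((x + 2 * ((n : ℝ) - 1) * c) / √(x ^ 2 + 2 * (2 * ((n : ℝ) - 1) * c) * x))) x := by
  have hn' : (3 : ℝ) ≤ n := by exact_mod_cast hn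
  have hp : 0 < 2 * ((n : ℝ) - 1) * c := mul_pos (by linarith) hc
  rw [funext (alphaF_eq n c)]
  refine ((((hasDerivAt_id x).const_mul _).const_add _).sub
    ((hasDerivAt_sqrt_sq_add hp hx).const_mul _)).congr_deriv ?_
  simp

lemma hasDerivAt_deriv_alphaF {n : ℕ} {c x : ℝ} (hn : 3 ≤ n) (hc : 0 < c) (hx : 0 < x) :
    HasDerivAt (deriv (alphaF n c)) (-(((n : ℝ) - 2) / (2 * ((n : ℝ) - 1)) *
      (-(2 * ((n : ℝ) - 1) * c) ^ 2 / √(x ^ 2 + 2 * (2 * ((n : ℝ) - 1) * c) * x) ^ 3))) x := by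
  have hn' : (3 : ℝ) ≤ n := by exact_mod_cast hn
  have hp : 0 < 2 * ((n : ℝ) - 1) * c := mul_pos (by linarith) hc
  refine (((hasDerivAt_div_sqrt_sq_add hp hx).const_mul _).const_sub _).congr_of_eventuallyEq
    ((eventually_gt_nhds hx).mono fun y hy ↦ (hasDerivAt_alphaF hn hc hy).deriv)

lemma gammaF_le_alphaF {n : ℕ} {c x : ℝ} (hn : 3 ≤ n) (hc : 0 < c) (hx : 0 ≤ x) :
    gammaF n c x ≤ alphaF n c x := by
  rw [gammaF]
  split_ifs with h
  · exact le_rfl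
  have hxa : x < x0 n c := not_le.1 h
  have ha : 0 < x0 n c := hx.trans_lt hxa
  have hn' : (3 : ℝ) ≤ n := by exact_mod_cast hn
  have hp : 0 < 2 * ((n : ℝ) - 1) * c := mul_pos (by linarith) hc
  have hk : 0 ≤ ((n : ℝ) - 2) / (2 * ((n : ℝ) - 1)) := div_nonneg (by linarith) (by linarith)
  have key := mul_le_mul_of_nonneg_left (sqrt_le_taylor_two hp hx hxa.le ha) hk
  rw [betaF, (hasDerivAt_alphaF hn hc ha).deriv, (hasDerivAt_deriv_alphaF hn hc ha).deriv,
    alphaF_eq, alphaF_eq]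
  linear_combination key

lemma sqrt_add_alphaF_eq {n : ℕ} {c x : ℝ} (hn : 3 ≤ n) (hc : 0 < c) (hx : 0 ≤ x) :
    ((n : ℝ) - 2) / √((n : ℝ) * ((n : ℝ) - 1)) * √(x * (alphaF n c x - x / n)) + alphaF n c x
      = 2 / n * x + n * c := by
  have hn' : (3 : ℝ) ≤ n := by exact_mod_cast hn
  have hn0 : (0 : ℝ) < n := by linarith
  have hn1 : (0 : ℝ) < (n : ℝ) - 1 := by linarith
  have hs2 : √(x ^ 2 + 4 * ((n : ℝ) - 1) * c * x) ^ 2 = x ^ 2 + 4 * ((n : ℝ) - 1) * c * x :=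
    Real.sq_sqrt (by positivity)
  have hxs : x ≤ √(x ^ 2 + 4 * ((n : ℝ) - 1) * c * x) :=
    Real.le_sqrt_of_sq_le (le_add_of_nonneg_right (by positivity))
  rw [alphaF]
  set s := √(x ^ 2 + 4 * ((n : ℝ) - 1) * c * x)
  have hr : 0 < √((n : ℝ) * ((n : ℝ) - 1)) := Real.sqrt_pos.2 (by positivity)
  have hr2 : √((n : ℝ) * ((n : ℝ) - 1)) ^ 2 = n * ((n : ℝ) - 1) := Real.sq_sqrt (by positivity)
  set r := √((n : ℝ) * ((n : ℝ) - 1))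
  have hnum : 0 ≤ n * s - ((n : ℝ) - 2) * x := by nlinarith
  have e : x * (n * c + n / (2 * ((n : ℝ) - 1)) * x - ((n : ℝ) - 2) / (2 * ((n : ℝ) - 1)) * s - x / n)
      = ((n * s - ((n : ℝ) - 2) * x) / (2 * r)) ^ 2 := by
    rw [div_pow, mul_pow, hr2]
    field_simp
    linear_combination (-(n : ℝ) ^ 2) * hs2
  rw [e, Real.sqrt_sq (by positivity)]
  have e2 : ((n : ℝ) - 2) / r * ((n * s - ((n : ℝ) - 2) * x) / (2 * r))
      = ((n : ℝ) - 2) * (n * s - ((n : ℝ) - 2) * x) / (2 * (n * ((n : ℝ) - 1))) := by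
    rw [← hr2]
    field_simp
  rw [e2]
  field_simp
  ring

theorem stmt_8 (n : ℕ) (hn : 3 ≤ n) (c : ℝ) (hc : 0 < c) (x : ℝ) (hx : 0 ≤ x) :
    (((n : ℝ) - 2) / Real.sqrt ((n : ℝ) * ((n : ℝ) - 1))) *
        Real.sqrt (x * (gammaF n c x - x / (n : ℝ))) + gammaF n c x ≤
      (2 / (n : ℝ)) * x + (n : ℝ) * c := by
  have hn' : (3 : ℝ) ≤ n := by exact_mod_cast hn
  have hk : 0 ≤ ((n : ℝ) - 2) / √((n : ℝ) * ((n : ℝ) - 1)) :=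
    div_nonneg (by linarith) (Real.sqrt_nonneg _)
  have h := gammaF_le_alphaF hn hc hx
  rw [← sqrt_add_alphaF_eq hn hc hx]
  gcongr
end

section
/- For every integer n ≥ 3, one has k_n > (9/5)·√(n−1). -/
open Real Filter

noncomputable def kn (n : ℕ) : ℝ :=
  if n = 3 then
    alphaF n 1 (yn n) - deriv (alphaF n 1) (yn n) * yn n
      + (1 / 2) * deriv (deriv (alphaF n 1)) (yn n) * (yn n) ^ 2
  else
    alphaF n 1 (yn n) - (deriv (alphaF n 1) (yn n)) ^ 2 / (2 * deriv (deriv (alphaF n 1)) (yn n))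

lemma alphaF_hasDerivAt (n : ℕ) (hn : 3 ≤ n) {x : ℝ} (hx : 0 < x) :
    HasDerivAt (alphaF n 1) ((n : ℝ) / (2 * ((n : ℝ) - 1)) - (((n : ℝ) - 2) / (2 * ((n : ℝ) - 1))) *
      ((x + 2 * ((n : ℝ) - 1)) / Real.sqrt (x ^ 2 + 4 * ((n : ℝ) - 1) * x))) x := by
  have hn' : (3 : ℝ) ≤ n := by exact_mod_cast hn
  have hm : (0 : ℝ) < (n : ℝ) - 1 := by linarith
  have hpos : 0 < x ^ 2 + 4 * ((n : ℝ) - 1) * 1 * x := by positivity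
  have hq : HasDerivAt (fun x : ℝ => x ^ 2 + 4 * ((n : ℝ) - 1) * 1 * x)
      (2 * x + 4 * ((n : ℝ) - 1)) x := by
    exact ((hasDerivAt_pow 2 x).add ((hasDerivAt_id x).const_mul (4 * ((n : ℝ) - 1) * 1))).congr_deriv (by simp)
  have hlin : HasDerivAt (fun x : ℝ => (n : ℝ) * 1 + ((n : ℝ) / (2 * ((n : ℝ) - 1))) * x)
      ((n : ℝ) / (2 * ((n : ℝ) - 1))) x := by
    simpa using ((hasDerivAt_id x).const_mul ((n : ℝ) / (2 * ((n : ℝ) - 1)))).const_add ((n : ℝ) * 1)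
  have h := hlin.sub ((hq.sqrt hpos.ne').const_mul (((n : ℝ) - 2) / (2 * ((n : ℝ) - 1))))
  refine h.congr_deriv ?_
  have hs := Real.sqrt_pos.2 hpos
  rw [mul_one] at hs ⊢
  field_simp
  ring

lemma alphaF_deriv_deriv (n : ℕ) (hn : 3 ≤ n) {x : ℝ} (hx : 0 < x) :
    deriv (deriv (alphaF n 1)) x = 2 * ((n : ℝ) - 1) * ((n : ℝ) - 2) /
      Real.sqrt (x ^ 2 + 4 * ((n : ℝ) - 1) * x) ^ 3 := by
  have hn' : (3 : ℝ) ≤ n := by exact_mod_cast hn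
  have hm : (0 : ℝ) < (n : ℝ) - 1 := by linarith
  have hpos : 0 < x ^ 2 + 4 * ((n : ℝ) - 1) * x := by positivity
  have hs := Real.sqrt_pos.2 hpos
  have hss := Real.sq_sqrt hpos.le
  have heq : deriv (alphaF n 1) =ᶠ[nhds x] fun x => (n : ℝ) / (2 * ((n : ℝ) - 1)) -
      (((n : ℝ) - 2) / (2 * ((n : ℝ) - 1))) *
      ((x + 2 * ((n : ℝ) - 1)) / Real.sqrt (x ^ 2 + 4 * ((n : ℝ) - 1) * x)) := by
    filter_upwards [lt_mem_nhds hx] with t ht using (alphaF_hasDerivAt n hn ht).deriv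
  rw [heq.deriv_eq]
  have hq : HasDerivAt (fun x : ℝ => x ^ 2 + 4 * ((n : ℝ) - 1) * x)
      (2 * x + 4 * ((n : ℝ) - 1)) x := by
    exact ((hasDerivAt_pow 2 x).add ((hasDerivAt_id x).const_mul (4 * ((n : ℝ) - 1)))).congr_deriv (by simp)
  have h := ((((hasDerivAt_id x).add_const (2 * ((n : ℝ) - 1))).div (hq.sqrt hpos.ne')
    hs.ne').const_mul (((n : ℝ) - 2) / (2 * ((n : ℝ) - 1)))).const_sub ((n : ℝ) / (2 * ((n : ℝ) - 1)))
  refine h.deriv.trans ?_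
  simp only [id]
  set s := Real.sqrt (x ^ 2 + 4 * ((n : ℝ) - 1) * x)
  field_simp
  rw [hss]
  ring

lemma yn_pos (n : ℕ) (hn : 3 ≤ n) : 0 < yn n := by
  have hn' : (3 : ℝ) ≤ n := by exact_mod_cast hn
  have hb : 0 < Real.sqrt (2 * (n : ℝ) - 5) := Real.sqrt_pos.2 (by linarith)
  have hbb : Real.sqrt (2 * (n : ℝ) - 5) ^ 2 = 2 * (n : ℝ) - 5 := Real.sq_sqrt (by linarith)
  unfold yn
  set b := Real.sqrt (2 * (n : ℝ) - 5)
  set A := ((n : ℝ) ^ 2 - 4 * (n : ℝ) + 6) / (2 * ((n : ℝ) - 1) * b)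
  have hA : 0 ≤ A := by
    apply div_nonneg
    · nlinarith
    · have : (0 : ℝ) < (n : ℝ) - 1 := by linarith
      positivity
  have h0 : 0 ≤ Real.arctan A := Real.arctan_nonneg.2 hA
  have h1 := Real.arctan_lt_pi_div_two A
  have hc : Real.sqrt 3 / 2 < Real.cos ((1 / 3) * Real.arctan A) := by
    rw [← Real.cos_pi_div_six]
    apply Real.cos_lt_cos_of_nonneg_of_le_pi_div_two <;> linarith [Real.pi_pos]
  have hN : (0 : ℝ) < 2 * ((n : ℝ) ^ 2 - 4) / b := by
    apply div_pos _ hb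
    nlinarith
  have h3 : 4 * ((n : ℝ) - 1) ≤ 2 * ((n : ℝ) ^ 2 - 4) / b * (Real.sqrt 3 / 2) := by
    rw [div_mul_div_comm, le_div_iff₀ (by positivity)]
    have h33 : Real.sqrt 3 ^ 2 = 3 := Real.sq_sqrt (by norm_num)
    refine le_of_pow_le_pow_left₀ two_ne_zero ?_ ?_
    rotate_left
    · have e1 : (4 * ((n : ℝ) - 1) * (b * 2)) ^ 2 = 64 * ((n : ℝ) - 1) ^ 2 * b ^ 2 := by ring
      have e2 : (2 * ((n : ℝ) ^ 2 - 4) * √3) ^ 2 = 4 * ((n : ℝ) ^ 2 - 4) ^ 2 * √3 ^ 2 := by ring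
      rw [e1, e2, hbb, h33]
      have : 0 ≤ ((n : ℝ) - 4) ^ 2 * (3 * (n : ℝ) ^ 2 - 8 * n + 8) :=
        mul_nonneg (sq_nonneg _) (by nlinarith)
      nlinarith
    · have : (0 : ℝ) ≤ (n : ℝ) ^ 2 - 4 := by nlinarith
      positivity
  nlinarith [mul_lt_mul_of_pos_left hc hN]

lemma yn_le (n : ℕ) (hn : 3 ≤ n) :
    yn n ≤ 4 * (1 - (n : ℝ)) + 2 * ((n : ℝ) ^ 2 - 4) / Real.sqrt (2 * (n : ℝ) - 5) := by
  have hn' : (3 : ℝ) ≤ n := by exact_mod_cast hn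
  unfold yn
  gcongr
  apply mul_le_of_le_one_right
  · apply div_nonneg _ (Real.sqrt_nonneg _)
    nlinarith
  · exact Real.cos_le_one _

lemma yn_div_add_two_le (n : ℕ) (hn : 4 ≤ n) :
    yn n / ((n : ℝ) - 1) + 2 ≤
      Real.sqrt (2 * ((n : ℝ) - 1)) + 1 / Real.sqrt (2 * ((n : ℝ) - 1)) := by
  have hn' : (4 : ℝ) ≤ n := by exact_mod_cast hn
  have hy := yn_le n (by omega)
  have hq : 0 < Real.sqrt (2 * ((n : ℝ) - 1)) := Real.sqrt_pos.2 (by linarith)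
  have hqq : Real.sqrt (2 * ((n : ℝ) - 1)) ^ 2 = 2 * ((n : ℝ) - 1) := Real.sq_sqrt (by linarith)
  have hb : 0 < Real.sqrt (2 * (n : ℝ) - 5) := Real.sqrt_pos.2 (by linarith)
  have hbb : Real.sqrt (2 * (n : ℝ) - 5) ^ 2 = 2 * (n : ℝ) - 5 := Real.sq_sqrt (by linarith)
  set b := Real.sqrt (2 * (n : ℝ) - 5)
  set q := Real.sqrt (2 * ((n : ℝ) - 1))
  have hnq : (n : ℝ) = q ^ 2 / 2 + 1 := by linarith
  have hb2 : b ^ 2 = q ^ 2 - 3 := by linarith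
  have hq6 : 6 ≤ q ^ 2 := by linarith
  have hq2 : 2.4 ≤ q := by nlinarith
  have key : (q ^ 2 - 2) * (q ^ 2 + 6) ≤ q * (q + 1) ^ 2 * b := by
    refine le_of_pow_le_pow_left₀ two_ne_zero (by positivity) ?_
    have e : (q * (q + 1) ^ 2 * b) ^ 2 = q ^ 2 * (q + 1) ^ 4 * (q ^ 2 - 3) := by
      rw [← hb2]; ring
    rw [e]
    obtain ⟨d, hqd⟩ : ∃ d, q = d + 2.4 := ⟨q - 2.4, by ring⟩
    have hd : 0 ≤ d := by linarith
    rw [← sub_nonneg, hqd]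
    ring_nf
    positivity
  have hm : (n : ℝ) - 1 = q ^ 2 / 2 := by linarith
  have h1 : yn n / ((n : ℝ) - 1) ≤ -4 + (q ^ 2 - 2) * (q ^ 2 + 6) / (q ^ 2 * b) := by
    rw [hm, div_le_iff₀ (by positivity)]
    refine hy.trans (le_of_eq ?_)
    rw [hnq]
    field_simp
    ring
  have h2 : (q ^ 2 - 2) * (q ^ 2 + 6) / (q ^ 2 * b) ≤ (q + 1) ^ 2 / q := by
    rw [div_le_div_iff₀ (by positivity) hq]
    nlinarith
  have h3 : (q + 1) ^ 2 / q = q + 1 / q + 2 := by field_simp; ring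
  linarith

lemma quartic_pos {w : ℝ} (hw : 0 < w) (hw2 : w ^ 2 ≤ 2) :
    0 < 3 + 6 * w ^ 2 - w ^ 4 - 7.2 * w := by
  have h : w ^ 4 ≤ 2 * w ^ 2 := by nlinarith [sq_nonneg w]
  nlinarith [sq_nonneg (w - 1), sq_nonneg (w - 0.9)]

lemma sextic_pos {w : ℝ} (hw : 0 < w) (hw2 : w ^ 2 ≤ 2) :
    0 < 8 * w ^ 2 * (w ^ 2 + 1) - (3 * w ^ 2 - 1) * (w ^ 2 - 1) ^ 2 - 14.4 * w ^ 3 := by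
  rcases le_total w 1 with h | h
  · have h6 : 0 ≤ w ^ 4 * (1 - w ^ 2) := mul_nonneg (by positivity) (by nlinarith)
    nlinarith [sq_nonneg (w ^ 2 - 0.6 * w - 0.1), sq_nonneg (w - 0.7), sq_nonneg (w * (w - 0.7))]
  · have h6 : 0 ≤ w ^ 4 * (2 - w ^ 2) := mul_nonneg (by positivity) (by nlinarith)
    obtain ⟨d, rfl⟩ : ∃ d, w = 1 + d := ⟨w - 1, by ring⟩
    have hd : 0 ≤ d := by linarith
    have hd2 : d ≤ 0.415 := by nlinarith
    nlinarith [mul_nonneg hd (sub_nonneg.2 hd2), pow_nonneg hd 3, pow_nonneg hd 4, pow_nonneg hd 5]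

lemma main_bound {m r z : ℝ} (hr : 0 < r) (hrm : r ^ 2 = m) (hm : 3 ≤ m) (hz : 0 < z)
    (hz2 : z ^ 2 ≤ 2 * m) :
    9 / 5 * r < z + m / z - (z - 1 / z) * (z - m / z) ^ 2 / (4 * (m - 1)) := by
  obtain ⟨w, rfl⟩ : ∃ w, z = r * w := ⟨z / r, by field_simp⟩
  have hw : 0 < w := pos_of_mul_pos_right hz hr.le
  subst hrm
  have hw2 : w ^ 2 ≤ 2 := by
    by_contra! h
    nlinarith [sq_nonneg r]
  have h1 := quartic_pos hw hw2
  have h2 := sextic_pos hw hw2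
  have hm1 : 0 < r ^ 2 - 1 := by linarith
  have key : 0 < 4 * (r ^ 2 - 1) * w ^ 2 * (w ^ 2 + 1) - (r ^ 2 * w ^ 2 - 1) * (w ^ 2 - 1) ^ 2
      - 7.2 * (r ^ 2 - 1) * w ^ 3 := by
    have : 0 ≤ (r ^ 2 - 3) * (w ^ 2 * (3 + 6 * w ^ 2 - w ^ 4 - 7.2 * w)) :=
      mul_nonneg (by linarith) (by positivity)
    nlinarith
  rw [← sub_pos]
  have e : r * w + r ^ 2 / (r * w) - (r * w - 1 / (r * w)) * (r * w - r ^ 2 / (r * w)) ^ 2 /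
      (4 * (r ^ 2 - 1)) - 9 / 5 * r = r * (4 * (r ^ 2 - 1) * w ^ 2 * (w ^ 2 + 1) -
      (r ^ 2 * w ^ 2 - 1) * (w ^ 2 - 1) ^ 2 - 7.2 * (r ^ 2 - 1) * w ^ 3) /
      (4 * (r ^ 2 - 1) * w ^ 3) := by
    field_simp
    ring
  rw [e]
  positivity

theorem stmt_10 (n : ℕ) (hn : 3 ≤ n) :
    kn n > (9 / 5) * Real.sqrt ((n : ℝ) - 1) := by
  have hn' : (3 : ℝ) ≤ n := by exact_mod_cast hn
  have hm : (0 : ℝ) < (n : ℝ) - 1 := by linarith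
  have hy := yn_pos n hn
  unfold kn
  rw [(alphaF_hasDerivAt n hn hy).deriv, alphaF_deriv_deriv n hn hy]
  unfold alphaF
  rw [mul_one (4 * ((n : ℝ) - 1))]
  have hpos : 0 < yn n ^ 2 + 4 * ((n : ℝ) - 1) * yn n := by positivity
  have hs := Real.sqrt_pos.2 hpos
  have hss := Real.sq_sqrt hpos.le
  split_ifs with h
  · subst h
    have hy2 : yn 3 ≤ 2 := by
      have := yn_le 3 le_rfl
      norm_num at this
      exact this
    have h2 : √(((3 : ℕ) : ℝ) - 1) ≤ 1.4143 := by
      rw [Real.sqrt_le_iff]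
      norm_num
    push_cast at *
    set y := yn 3
    set s := √(y ^ 2 + 4 * (3 - 1) * y)
    have hsy : s ^ 2 = y * (y + 8) := by rw [hss]; ring
    have key : y ^ 2 * (y + 6) < 0.45 * s ^ 3 := by
      apply lt_of_pow_lt_pow_left₀ 2 (by positivity)
      have e : (0.45 * s ^ 3) ^ 2 = 0.2025 * (y * (y + 8)) ^ 3 := by rw [← hsy]; ring
      rw [e]
      have : 0 < 0.2025 * (y + 8) ^ 3 - y * (y + 6) ^ 2 := by nlinarith
      have := mul_pos (pow_pos hy 3) this
      nlinarith
    have e : (3 : ℝ) * 1 + 3 / (2 * (3 - 1)) * y - (3 - 2) / (2 * (3 - 1)) * s -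
        (3 / (2 * (3 - 1)) - (3 - 2) / (2 * (3 - 1)) * ((y + 2 * (3 - 1)) / s)) * y +
        1 / 2 * (2 * (3 - 1) * (3 - 2) / s ^ 3) * y ^ 2 = 3 - y ^ 2 * (y + 6) / s ^ 3 := by
      have h4 : s ^ 4 = (y * (y + 8)) ^ 2 := by rw [← hsy]; ring
      field_simp
      ring_nf
      rw [h4, hsy]
      ring
    rw [e]
    have : y ^ 2 * (y + 6) / s ^ 3 < 0.45 := by rwa [div_lt_iff₀ (by positivity)]
    linarith
  · have hn4 : 4 ≤ n := by omega
    have hn4' : (4 : ℝ) ≤ n := by exact_mod_cast hn4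
    have hle := yn_div_add_two_le n hn4
    obtain ⟨m, hmn⟩ : ∃ m : ℝ, (n : ℝ) = m + 1 := ⟨n - 1, by ring⟩
    rw [hmn] at hm hpos hs hss hle hn4' ⊢
    simp only [add_sub_cancel_right] at hm hpos hs hss hle ⊢
    set y := yn n
    set s := √(y ^ 2 + 4 * m * y)
    set z := (y + 2 * m + s) / (2 * m) with hzdef
    have hz : 0 < z := by positivity
    have hz1 : 1 ≤ z := by
      rw [hzdef, le_div_iff₀ (by positivity)]
      linarith
    have hinv : 1 / z = (y + 2 * m - s) / (2 * m) := by
      rw [hzdef, one_div_div, div_eq_div_iff (by positivity) (by positivity)]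
      nlinarith
    have hsum : z + 1 / z = y / m + 2 := by
      rw [hinv, hzdef]
      field_simp
      ring
    have hq : 0 < √(2 * m) := Real.sqrt_pos.2 (by linarith)
    have hqq : √(2 * m) ^ 2 = 2 * m := Real.sq_sqrt (by linarith)
    have hz2 : z ^ 2 ≤ 2 * m := by
      rw [← hqq]
      set q := √(2 * m)
      have hq1 : 1 ≤ q := by nlinarith
      have hle' : z + 1 / z ≤ q + 1 / q := hsum ▸ hle
      have : z ≤ q := by
        by_contra! hlt
        have e : z + 1 / z - (q + 1 / q) = (z - q) * (z * q - 1) / (z * q) := by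
          field_simp
          ring
        have : 0 < (z - q) * (z * q - 1) / (z * q) :=
          div_pos (mul_pos (by linarith) (by nlinarith)) (by positivity)
        linarith
      gcongr
    have hb := main_bound (Real.sqrt_pos.2 hm) (Real.sq_sqrt hm.le) (by linarith) hz hz2
    refine lt_of_lt_of_eq hb ?_
    have hzm : m / z = (y + 2 * m - s) / 2 := by
      rw [div_eq_mul_one_div, hinv]
      field_simp
    have hm1 : 0 < m - 1 := by linarith
    have hm2 : m + 1 - 2 = m - 1 := by ring
    rw [hzm, hinv, hzdef, hm2]
    field_simp
    ring
end

section
/- For every integer n with 5 ≤ n ≤ 9, one has k_n > 1.999·√(n−1). -/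
open Real Filter

lemma lt_of_cubic_lt {p q r a z : ℝ} (hq : 0 ≤ q) (hr : 0 ≤ r) (hz : 0 < z) (ha : 0 < a)
    (hroot : p * z ^ 3 = q * z + r) (h : p * a ^ 3 < q * a + r) : a < z := by
  by_contra! hza
  have h₃ : p * a ^ 3 * z ^ 3 < (q * a + r) * z ^ 3 := by gcongr
  have h₄ : q * (a * z) * z ^ 2 ≤ q * (a * z) * a ^ 2 := by gcongr
  have h₅ : r * z ^ 3 ≤ r * a ^ 3 := by gcongr
  have h₆ := congrArg (a ^ 3 * ·) hroot
  linarith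

lemma lt_of_lt_cubic {p q r b z : ℝ} (hq : 0 ≤ q) (hr : 0 ≤ r) (hz : 0 < z) (hb : 0 < b)
    (hroot : p * z ^ 3 = q * z + r) (h : q * b + r < p * b ^ 3) : z < b := by
  by_contra! hbz
  have h₃ : (q * b + r) * z ^ 3 < p * b ^ 3 * z ^ 3 := by gcongr
  have h₄ : q * (b * z) * b ^ 2 ≤ q * (b * z) * z ^ 2 := by gcongr
  have h₅ : r * b ^ 3 ≤ r * z ^ 3 := by gcongr
  have h₆ := congrArg (b ^ 3 * ·) hroot
  linarith

lemma cos_third_arctan_pos (t : ℝ) : 0 < cos (1 / 3 * arctan t) := by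
  apply cos_pos_of_mem_Ioo
  constructor <;> linarith [neg_pi_div_two_lt_arctan t, arctan_lt_pi_div_two t, pi_pos]

lemma cubic_cos_third_arctan (t : ℝ) :
    4 * cos (1 / 3 * arctan t) ^ 3 - 3 * cos (1 / 3 * arctan t) = 1 / √(1 + t ^ 2) := by
  rw [← cos_three_mul, ← cos_arctan]
  congr 1
  ring

lemma yn_add_pos {n : ℕ} (hn : 3 ≤ n) : 0 < yn n + 4 * ((n : ℝ) - 1) := by
  have hn' : (3 : ℝ) ≤ n := by exact_mod_cast hn
  have hs : 0 < √(2 * (n : ℝ) - 5) := sqrt_pos.2 (by linarith)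
  have hN : 0 < (n : ℝ) ^ 2 - 4 := by nlinarith
  rw [yn]
  have := mul_pos (div_pos (mul_pos two_pos hN) hs)
    (cos_third_arctan_pos (((n : ℝ) ^ 2 - 4 * n + 6) / (2 * (n - 1) * √(2 * n - 5))))
  linarith

/-- `yn n` is a root of a cubic, whose trigonometric solution is the defining formula. -/
lemma yn_cubic {n : ℕ} (hn : 3 ≤ n) :
    (2 * (n : ℝ) - 5) * (yn n + 4 * ((n : ℝ) - 1)) ^ 3 =
      3 * ((n : ℝ) ^ 2 - 4) ^ 2 * (yn n + 4 * ((n : ℝ) - 1))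
        + 4 * ((n : ℝ) - 1) * ((n : ℝ) ^ 2 - 4) ^ 2 := by
  have hn' : (3 : ℝ) ≤ n := by exact_mod_cast hn
  rw [yn]
  generalize (n : ℝ) = N at *
  have hs : 0 < √(2 * N - 5) := sqrt_pos.2 (by linarith)
  have hs2 : √(2 * N - 5) ^ 2 = 2 * N - 5 := sq_sqrt (by linarith)
  have hN : 0 < N ^ 2 - 4 := by nlinarith
  have hm : 0 < N - 1 := by linarith
  have hc := cubic_cos_third_arctan ((N ^ 2 - 4 * N + 6) / (2 * (N - 1) * √(2 * N - 5)))
  generalize cos (1 / 3 * arctan ((N ^ 2 - 4 * N + 6) / (2 * (N - 1) * √(2 * N - 5)))) = c at *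
  generalize √(2 * N - 5) = s at *
  have ht : √(1 + ((N ^ 2 - 4 * N + 6) / (2 * (N - 1) * s)) ^ 2)
      = (N ^ 2 - 4) / (2 * (N - 1) * s) := by
    rw [← sqrt_sq (show 0 ≤ (N ^ 2 - 4) / (2 * (N - 1) * s) by positivity)]
    congr 1
    field_simp
    linear_combination 4 * (N - 1) ^ 2 * hs2
  rw [ht, one_div_div] at hc
  have hc' : (4 * c ^ 3 - 3 * c) * (N ^ 2 - 4) = 2 * (N - 1) * s := by
    rw [hc]; field_simp
  have hz : 4 * (1 - N) + 2 * (N ^ 2 - 4) / s * c + 4 * (N - 1) = 2 * (N ^ 2 - 4) * c / s := by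
    ring
  rw [hz, ← hs2]
  field_simp
  linear_combination 2 * hc'

lemma hasDerivAt_sqrt_quadratic {m x : ℝ} (hm : 0 ≤ m) (hx : 0 < x) :
    HasDerivAt (fun x : ℝ => √(x ^ 2 + 4 * m * 1 * x)) ((x + 2 * m) / √(x ^ 2 + 4 * m * x)) x := by
  have h : HasDerivAt (fun x : ℝ => x ^ 2 + 4 * m * 1 * x) (2 * x + 4 * m) x := by
    have h := (hasDerivAt_pow 2 x).add ((hasDerivAt_id x).const_mul (4 * m * 1))
    refine h.congr_deriv ?_
    simp
  convert h.sqrt (by positivity) using 1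
  rw [mul_one]
  have : 0 < √(x ^ 2 + 4 * m * x) := sqrt_pos.2 (by positivity)
  field_simp
  ring

lemma deriv_alphaF {n : ℕ} (hn : 1 ≤ n) {x : ℝ} (hx : 0 < x) :
    deriv (alphaF n 1) x = (n : ℝ) / (2 * (n - 1))
      - ((n : ℝ) - 2) / (2 * (n - 1)) * ((x + 2 * (n - 1)) / √(x ^ 2 + 4 * (n - 1) * x)) := by
  have hm : (0 : ℝ) ≤ n - 1 := sub_nonneg.2 (by exact_mod_cast hn)
  have h := ((((hasDerivAt_id x).const_mul ((n : ℝ) / (2 * (n - 1)))).const_add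
    ((n : ℝ) * 1)).sub ((hasDerivAt_sqrt_quadratic hm hx).const_mul
      (((n : ℝ) - 2) / (2 * (n - 1))))).deriv
  refine h.trans ?_
  simp only [mul_one]

lemma deriv_deriv_alphaF {n : ℕ} (hn : 1 ≤ n) {x : ℝ} (hx : 0 < x) :
    deriv (deriv (alphaF n 1)) x = ((n : ℝ) - 2) / (2 * (n - 1))
      * (4 * ((n : ℝ) - 1) ^ 2 / √(x ^ 2 + 4 * (n - 1) * x) ^ 3) := by
  have hm : (0 : ℝ) ≤ n - 1 := sub_nonneg.2 (by exact_mod_cast hn)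
  have heq : deriv (alphaF n 1) =ᶠ[nhds x] fun x => (n : ℝ) / (2 * (n - 1))
      - ((n : ℝ) - 2) / (2 * (n - 1)) * ((x + 2 * (n - 1)) / √(x ^ 2 + 4 * (n - 1) * 1 * x)) := by
    filter_upwards [lt_mem_nhds hx] with z hz
    rw [deriv_alphaF hn hz, mul_one]
  have hpos : 0 < x ^ 2 + 4 * ((n : ℝ) - 1) * x := by positivity
  have hs : 0 < √(x ^ 2 + 4 * ((n : ℝ) - 1) * x) := sqrt_pos.2 hpos
  have hs2 := sq_sqrt hpos.le
  have h := ((((hasDerivAt_id x).add_const (2 * ((n : ℝ) - 1))).div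
    (hasDerivAt_sqrt_quadratic hm hx) (by rw [mul_one]; exact hs.ne')).const_mul
      (((n : ℝ) - 2) / (2 * (n - 1)))).const_sub ((n : ℝ) / (2 * (n - 1)))
  rw [heq.deriv_eq]
  refine h.deriv.trans ?_
  simp only [id, mul_one]
  generalize √(x ^ 2 + 4 * ((n : ℝ) - 1) * x) = s at *
  rw [← mul_neg]
  congr 1
  field_simp
  linear_combination -hs2

/-- Interval enclosure for the minimum of the second-order Taylor polynomial of `alphaF n 1`. -/
lemma lt_taylor_min {n : ℕ} (hn : 3 ≤ n) {y y₁ y₂ s₁ s₂ d r : ℝ} (hy₁ : 0 < y₁)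
    (h₁ : y₁ ≤ y) (h₂ : y ≤ y₂) (hs₁ : 0 < s₁) (hs₂ : 0 < s₂)
    (hsq₁ : s₁ ^ 2 ≤ y₁ ^ 2 + 4 * (n - 1) * y₁) (hsq₂ : y₂ ^ 2 + 4 * (n - 1) * y₂ ≤ s₂ ^ 2)
    (hd₁ : (n : ℝ) / (2 * (n - 1)) - (n - 2) / (2 * (n - 1)) * ((y₁ + 2 * (n - 1)) / s₂) ≤ d)
    (hd₂ : -d ≤ (n : ℝ) / (2 * (n - 1)) - (n - 2) / (2 * (n - 1)) * ((y₂ + 2 * (n - 1)) / s₁))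
    (hr : r < n + (n : ℝ) / (2 * (n - 1)) * y₁ - (n - 2) / (2 * (n - 1)) * s₂
      - d ^ 2 * (s₂ ^ 3 / (4 * (n - 1) * (n - 2)))) :
    r < alphaF n 1 y - (deriv (alphaF n 1) y) ^ 2 / (2 * deriv (deriv (alphaF n 1)) y) := by
  have hn' : (3 : ℝ) ≤ n := by exact_mod_cast hn
  have hy : 0 < y := hy₁.trans_le h₁
  rw [deriv_deriv_alphaF (by omega) hy, deriv_alphaF (by omega) hy, alphaF]
  simp only [mul_one]
  generalize (n : ℝ) = N at *
  have hm : 0 < N - 1 := by linarith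
  have hk : 0 < N - 2 := by linarith
  have hs : 0 < √(y ^ 2 + 4 * (N - 1) * y) := sqrt_pos.2 (by positivity)
  have hl : s₁ ≤ √(y ^ 2 + 4 * (N - 1) * y) := le_sqrt_of_sq_le (hsq₁.trans (by gcongr))
  have hu : √(y ^ 2 + 4 * (N - 1) * y) ≤ s₂ :=
    sqrt_le_iff.2 ⟨hs₂.le, le_trans (by gcongr) hsq₂⟩
  generalize √(y ^ 2 + 4 * (N - 1) * y) = s at *
  have hy₂ : 0 < y₂ := hy.trans_le h₂
  have hb₁ : N / (2 * (N - 1)) - (N - 2) / (2 * (N - 1)) * ((y + 2 * (N - 1)) / s) ≤ d :=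
    le_trans (by gcongr) hd₁
  have hb₂ : -d ≤ N / (2 * (N - 1)) - (N - 2) / (2 * (N - 1)) * ((y + 2 * (N - 1)) / s) :=
    hd₂.trans (by gcongr)
  generalize N / (2 * (N - 1)) - (N - 2) / (2 * (N - 1)) * ((y + 2 * (N - 1)) / s) = e at *
  have he : e ^ 2 ≤ d ^ 2 := sq_le_sq' hb₂ hb₁
  have hquot : e ^ 2 / (2 * ((N - 2) / (2 * (N - 1)) * (4 * (N - 1) ^ 2 / s ^ 3)))
      = e ^ 2 * (s ^ 3 / (4 * (N - 1) * (N - 2))) := by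
    field_simp
  rw [hquot]
  refine hr.trans_le ?_
  gcongr

/-- `lt_taylor_min` at `yn n`, with the enclosure of `yn n` checked on its cubic. -/
lemma lt_taylor_min_yn {n : ℕ} (hn : 3 ≤ n) (y₁ y₂ s₁ s₂ d r : ℝ) (hy₁ : 0 < y₁) (hy₂ : 0 < y₂)
    (hc₁ : (2 * (n : ℝ) - 5) * (y₁ + 4 * (n - 1)) ^ 3 <
      3 * ((n : ℝ) ^ 2 - 4) ^ 2 * (y₁ + 4 * (n - 1)) + 4 * (n - 1) * ((n : ℝ) ^ 2 - 4) ^ 2)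
    (hc₂ : 3 * ((n : ℝ) ^ 2 - 4) ^ 2 * (y₂ + 4 * (n - 1)) + 4 * (n - 1) * ((n : ℝ) ^ 2 - 4) ^ 2 <
      (2 * (n : ℝ) - 5) * (y₂ + 4 * (n - 1)) ^ 3)
    (hs₁ : 0 < s₁) (hs₂ : 0 < s₂)
    (hsq₁ : s₁ ^ 2 ≤ y₁ ^ 2 + 4 * (n - 1) * y₁) (hsq₂ : y₂ ^ 2 + 4 * (n - 1) * y₂ ≤ s₂ ^ 2)
    (hd₁ : (n : ℝ) / (2 * (n - 1)) - (n - 2) / (2 * (n - 1)) * ((y₁ + 2 * (n - 1)) / s₂) ≤ d)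
    (hd₂ : -d ≤ (n : ℝ) / (2 * (n - 1)) - (n - 2) / (2 * (n - 1)) * ((y₂ + 2 * (n - 1)) / s₁))
    (hr₀ : 0 ≤ r) (hr₁ : (n : ℝ) - 1 ≤ r ^ 2)
    (hr : 1.999 * r < n + (n : ℝ) / (2 * (n - 1)) * y₁ - (n - 2) / (2 * (n - 1)) * s₂
      - d ^ 2 * (s₂ ^ 3 / (4 * (n - 1) * (n - 2)))) :
    alphaF n 1 (yn n) - (deriv (alphaF n 1) (yn n)) ^ 2 / (2 * deriv (deriv (alphaF n 1)) (yn n))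
      > 1.999 * √((n : ℝ) - 1) := by
  have hm : (0 : ℝ) < n - 1 := sub_pos.2 (by exact_mod_cast (by omega : 1 < n))
  have hz := yn_add_pos hn
  have hroot := yn_cubic hn
  have h₁ := lt_of_cubic_lt (by positivity) (by positivity) hz (by positivity) hroot hc₁
  have h₂ := lt_of_lt_cubic (by positivity) (by positivity) hz (by positivity) hroot hc₂
  refine lt_of_le_of_lt ?_ (lt_taylor_min hn hy₁ (by linarith) (by linarith) hs₁ hs₂ hsq₁ hsq₂
    hd₁ hd₂ hr)
  gcongr
  exact sqrt_le_iff.2 ⟨hr₀, hr₁⟩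

theorem stmt_11 (n : ℕ) (hn5 : 5 ≤ n) (hn9 : n ≤ 9) :
    alphaF n 1 (yn n) - (deriv (alphaF n 1) (yn n)) ^ 2 / (2 * deriv (deriv (alphaF n 1)) (yn n))
      > 1.999 * Real.sqrt ((n : ℝ) - 1) := by
  interval_cases n
  · exact lt_taylor_min_yn (by norm_num) (246669/100000) (24667/10000) (674919/100000) (674921/100000)
      (87/2000) 2
      (by norm_num) (by norm_num) (by norm_num) (by norm_num) (by norm_num) (by norm_num)
      (by norm_num) (by norm_num) (by norm_num) (by norm_num) (by norm_num) (by norm_num)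
      (by norm_num)
  · exact lt_taylor_min_yn (by norm_num) (11599/3125) (371169/100000) (938137/100000) (938139/100000)
      (77/5000) (223607/100000)
      (by norm_num) (by norm_num) (by norm_num) (by norm_num) (by norm_num) (by norm_num)
      (by norm_num) (by norm_num) (by norm_num) (by norm_num) (by norm_num) (by norm_num)
      (by norm_num)
  · exact lt_taylor_min_yn (by norm_num) (33203/6250) (531249/100000) (623943/50000) (77993/6250)
      (53/10000) (244949/100000)
      (by norm_num) (by norm_num) (by norm_num) (by norm_num) (by norm_num) (by norm_num)
      (by norm_num) (by norm_num) (by norm_num) (by norm_num) (by norm_num) (by norm_num)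
      (by norm_num)
  · exact lt_taylor_min_yn (by norm_num) (361997/50000) (144799/20000) (798647/50000) (1597297/100000)
      (1/625) (8268/3125)
      (by norm_num) (by norm_num) (by norm_num) (by norm_num) (by norm_num) (by norm_num)
      (by norm_num) (by norm_num) (by norm_num) (by norm_num) (by norm_num) (by norm_num)
      (by norm_num)
  · exact lt_taylor_min_yn (by norm_num) (189487/20000) (236859/25000) (1982277/100000) (49557/2500)
      (3/10000) (282843/100000)
      (by norm_num) (by norm_num) (by norm_num) (by norm_num) (by norm_num) (by norm_num)
      (by norm_num) (by norm_num) (by norm_num) (by norm_num) (by norm_num) (by norm_num)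
      (by norm_num)
end
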